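/- With notation as in the previous lemma, for f ∈ 𝒮(ℝⁿ) the exact identity holds: ⟨γS_tf + γ[S,A]f + γ̇Sf, f⟩ = ∫ 8γa |-i∇f + (ḃ/2)f + (ȧ/(2a) + γ̇/(4γ))(x+b)f|² dx + ∫ F(a,γ)|x + b + aγb̈/F(a,γ)|² |f|² dx - (γ²a²|b̈|²/F(a,γ)) ∫ |f|² dx. -/

import Mathlib

open Set MeasureTheory

/-- Partial derivative in the `i`-th coordinate. -/
noncomputable def pd (n : ℕ) (i : Fin n) (f : (Fin n → ℝ) → ℂ) (x : Fin n → ℝ) : ℂ :=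
  deriv (fun s => f (Function.update x i s)) (x i)

/-- Spatial Laplacian on `ℝⁿ`. -/
noncomputable def lap (n : ℕ) (f : (Fin n → ℝ) → ℂ) (x : Fin n → ℝ) : ℂ :=
  ∑ i, pd n i (pd n i f) x

section Commutators

theorem sum_mul_sum_sub_sum_mul_sum {R ι : Type*} [Ring R] [Fintype ι] (F G : ι → R) :
    (∑ i, F i) * (∑ j, G j) - (∑ j, G j) * ∑ i, F i = ∑ i, ∑ j, (F i * G j - G j * F i) := by
  rw [Finset.sum_mul_sum, Finset.sum_mul_sum, Finset.sum_comm (f := fun i j => G i * F j)]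
  simp only [Finset.sum_sub_distrib]

variable {R ι : Type*} [Ring R] [Fintype ι] [DecidableEq ι] {P Q : ι → R}

theorem lie_sum_mul_sum_sq (hP : ∀ i j, Commute (P i) (P j))
    (hPQ : ∀ i j, P i * Q j = Q j * P i + if i = j then 1 else 0) :
    ⁅∑ i, Q i * P i, ∑ j, P j * P j⁆ = -(2 * ∑ i, P i * P i) := by
  have key (i j : ι) : ⁅Q i * P i, P j * P j⁆ = if i = j then -(2 * (P i * P i)) else 0 := by
    have h := hPQ j i
    have hc := (hP i j).eq
    rw [Ring.lie_def]
    have e : P j * P j * (Q i * P i) = P j * (P j * Q i) * P i := by noncomm_ring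
    rw [e, h, mul_add, add_mul, ← mul_assoc (P j) (Q i), h]
    have e' : Q i * P i * (P j * P j) = Q i * P j * P j * P i := by
      rw [mul_assoc, ← mul_assoc (P i), hc, mul_assoc (P j), hc]; noncomm_ring
    rw [e']
    by_cases hij : i = j
    · subst hij; simp; noncomm_ring
    · simp [hij, Ne.symm hij]
  simp only [Ring.lie_def] at key ⊢
  simp only [sum_mul_sum_sub_sum_mul_sum, key]
  simp [Finset.mul_sum]

theorem lie_sum_mul_sum_sq_left (hQ : ∀ i j, Commute (Q i) (Q j))
    (hPQ : ∀ i j, P i * Q j = Q j * P i + if i = j then 1 else 0) :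
    ⁅∑ i, Q i * P i, ∑ j, Q j * Q j⁆ = 2 * ∑ i, Q i * Q i := by
  have key (i j : ι) : ⁅Q i * P i, Q j * Q j⁆ = if i = j then 2 * (Q i * Q i) else 0 := by
    have h := hPQ i j
    have hc := (hQ i j).eq
    rw [Ring.lie_def]
    have e : Q i * P i * (Q j * Q j) = Q i * (P i * Q j) * Q j := by noncomm_ring
    have e1 : Q i * (Q j * P i) * Q j = Q i * Q j * (P i * Q j) := by noncomm_ring
    have e2 : Q j * Q j * (Q i * P i) = Q i * Q j * Q j * P i := by
      rw [hc, mul_assoc (Q j) (Q i), hc]; noncomm_ring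
    rw [e, h, mul_add, add_mul, e1, h, e2]
    by_cases hij : i = j
    · subst hij; simp; noncomm_ring
    · simp [hij]; noncomm_ring
  simp only [Ring.lie_def] at key ⊢
  simp only [sum_mul_sum_sub_sum_mul_sum, key]
  simp [Finset.mul_sum]

theorem lie_sum_sq_sum_sq (hPQ : ∀ i j, P i * Q j = Q j * P i + if i = j then 1 else 0) :
    ⁅∑ i, Q i * Q i, ∑ j, P j * P j⁆ = -(4 * ∑ i, Q i * P i) - 2 * (Fintype.card ι : R) := by
  have key (i j : ι) : ⁅Q i * Q i, P j * P j⁆ = if i = j then -(4 * (Q i * P i)) - 2 else 0 := by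
    have h := hPQ j i
    rw [Ring.lie_def]
    have e : P j * P j * (Q i * Q i) = P j * (P j * Q i) * Q i := by noncomm_ring
    have e1 : P j * (Q i * P j) * Q i = (P j * Q i) * (P j * Q i) := by noncomm_ring
    rw [e, h, mul_add, add_mul, e1, h]
    by_cases hij : i = j
    · subst hij
      simp only [if_true, mul_one, add_mul, mul_add, one_mul]
      have e2 : Q i * P i * (Q i * P i) = Q i * (P i * Q i) * P i := by noncomm_ring
      rw [e2, h]
      simp only [if_true, ← one_add_one_eq_two]; noncomm_ring
    · simp only [Ne.symm hij, hij, if_false, add_zero, mul_zero, zero_mul]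
      have e2 : Q i * P j * (Q i * P j) = Q i * (P j * Q i) * P j := by noncomm_ring
      rw [e2, h]
      simp only [Ne.symm hij, if_false]; noncomm_ring
  simp only [Ring.lie_def] at key ⊢
  simp only [sum_mul_sum_sub_sum_mul_sum, key]
  simp [Finset.mul_sum, Finset.sum_sub_distrib, (Nat.cast_commute _ _).eq]

theorem lie_sum_smul_sum_sq [Algebra ℂ R] (β : ι → ℂ)
    (hPQ : ∀ i j, P i * Q j = Q j * P i + if i = j then 1 else 0) :
    ⁅∑ i, β i • Q i, ∑ j, P j * P j⁆ = -(2 * ∑ i, β i • P i) := by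
  have key (i j : ι) : ⁅β i • Q i, P j * P j⁆ = if i = j then -(2 * β i • P i) else 0 := by
    have h := hPQ j i
    rw [Ring.lie_def, smul_mul_assoc, mul_smul_comm, ← smul_sub, mul_assoc (P j), h, mul_add,
      ← mul_assoc (P j) (Q i), h]
    by_cases hij : i = j
    · subst hij
      simp only [if_true, mul_smul_comm, ← smul_neg]
      congr 1; noncomm_ring
    · simp [Ne.symm hij, hij]; simp [mul_assoc]
  simp only [Ring.lie_def] at key ⊢
  simp only [sum_mul_sum_sub_sum_mul_sum, key]
  simp [Finset.mul_sum]

end Commutators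

section Schwartz

open scoped LineDeriv SchwartzMap

variable {n : ℕ}

/-- Coordinate derivative of Schwartz functions. -/
noncomputable def schwartzD (i : Fin n) : Module.End ℂ 𝓢(Fin n → ℝ, ℂ) :=
  (LineDeriv.lineDerivOpCLM ℂ 𝓢(Fin n → ℝ, ℂ) (Pi.single i (1 : ℝ) : Fin n → ℝ)).toLinearMap

/-- Multiplication of Schwartz functions by a translated coordinate. -/
noncomputable def schwartzX (v : Fin n → ℝ) (i : Fin n) :
    Module.End ℂ 𝓢(Fin n → ℝ, ℂ) :=
  (SchwartzMap.smulLeftCLM ℂ (fun x : Fin n → ℝ => ((x i + v i : ℝ) : ℂ))).toLinearMap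

theorem schwartzX_apply (v : Fin n → ℝ) (i : Fin n) (f : 𝓢(Fin n → ℝ, ℂ)) (x : Fin n → ℝ) :
    schwartzX v i f x = ((x i + v i : ℝ) : ℂ) * f x := by
  have h : (fun x : Fin n → ℝ => x i).HasTemperateGrowth :=
    (ContinuousLinearMap.proj (R := ℝ) (φ := fun _ : Fin n => ℝ) i).hasTemperateGrowth
  refine SchwartzMap.smulLeftCLM_apply_apply ?_ f x
  exact Complex.ofRealCLM.hasTemperateGrowth.comp (h.add (.const _))

theorem schwartzD_apply (i : Fin n) (f : 𝓢(Fin n → ℝ, ℂ)) (x : Fin n → ℝ) :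
    schwartzD i f x = fderiv ℝ f x (Pi.single i 1) :=
  rfl

theorem pd_schwartz (i : Fin n) (f : 𝓢(Fin n → ℝ, ℂ)) : pd n i f = schwartzD i f := by
  funext x
  have h := hasDerivAt_update x i (x i)
  have hf : HasFDerivAt f (fderiv ℝ f x) (Function.update x i (x i)) := by
    simpa using f.hasFDerivAt x
  exact (hf.comp_hasDerivAt (x i) h).deriv

theorem lap_schwartz (f : 𝓢(Fin n → ℝ, ℂ)) (x : Fin n → ℝ) :
    lap n f x = ∑ i, schwartzD i (schwartzD i f) x := by
  simp [lap, pd_schwartz]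

theorem schwartzX_commute (v : Fin n → ℝ) (i j : Fin n) :
    Commute (schwartzX v i) (schwartzX v j) := by
  refine LinearMap.ext fun f => SchwartzMap.ext fun x => ?_
  simp only [Module.End.mul_apply, schwartzX_apply]
  ring

theorem schwartzD_commute (i j : Fin n) : Commute (schwartzD i) (schwartzD j) := by
  refine LinearMap.ext fun f => SchwartzMap.ext fun x => ?_
  have hd : DifferentiableAt ℝ (fderiv ℝ f) x :=
    ((f.smooth 2).fderiv_right (m := 1) (by norm_num)).differentiable (by norm_num) x
  have key (i j : Fin n) : schwartzD i (schwartzD j f) x =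
      fderiv ℝ (fderiv ℝ f) x (Pi.single i 1) (Pi.single j 1) := by
    rw [schwartzD_apply]
    change fderiv ℝ (fun y => fderiv ℝ f y (Pi.single j 1)) x _ = _
    rw [fderiv_clm_apply hd (differentiableAt_const _)]
    simp
  simp only [Module.End.mul_apply, key]
  exact ((f.smooth 2).contDiffAt.isSymmSndFDerivAt (by simp)) _ _

theorem schwartzD_mul_schwartzX (v : Fin n → ℝ) (i j : Fin n) :
    schwartzD i * schwartzX v j = schwartzX v j * schwartzD i + if i = j then 1 else 0 := by
  refine LinearMap.ext fun f => SchwartzMap.ext fun x => ?_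
  have e : (schwartzX v j f : (Fin n → ℝ) → ℂ) = fun y => ((y j + v j : ℝ) : ℂ) * f y :=
    funext fun y => schwartzX_apply v j f y
  have h1 : HasFDerivAt (fun y : Fin n → ℝ => ((y j + v j : ℝ) : ℂ))
      (Complex.ofRealCLM.comp (ContinuousLinearMap.proj j)) x :=
    Complex.ofRealCLM.hasFDerivAt.comp x ((hasFDerivAt_apply j x).add_const (v j))
  have h2 := h1.mul (f.hasFDerivAt x)
  rw [Module.End.mul_apply, schwartzD_apply, e]
  erw [h2.fderiv]
  by_cases hij : i = j
  · subst hij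
    simp [schwartzX_apply, schwartzD_apply]
  · simp [schwartzX_apply, schwartzD_apply, hij, Ne.symm hij]

theorem schwartzD_schwartzX_self (v : Fin n → ℝ) (i : Fin n) (f : 𝓢(Fin n → ℝ, ℂ)) :
    schwartzD i (schwartzX v i f) = schwartzX v i (schwartzD i f) + f := by
  simpa using LinearMap.congr_fun (schwartzD_mul_schwartzX v i i) f

/-- The symmetric operator on Schwartz functions; `a'` and `β` stand for the time derivatives of
`a` and `v`. -/
noncomputable def symOp (a a' : ℝ) (v β : Fin n → ℝ) : Module.End ℂ 𝓢(Fin n → ℝ, ℂ) :=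
  (-2 * Complex.I) • ((2 * (a : ℂ)) • ∑ i, schwartzX v i * schwartzD i + ((a : ℂ) * n) • 1) +
    (a' : ℂ) • ∑ i, schwartzX v i * schwartzX v i +
    (2 * (a : ℂ)) • ∑ i, (β i : ℂ) • schwartzX v i

/-- The antisymmetric operator on Schwartz functions. -/
noncomputable def antiOp (a : ℝ) (v : Fin n → ℝ) : Module.End ℂ 𝓢(Fin n → ℝ, ℂ) :=
  Complex.I • (∑ i, schwartzD i * schwartzD i +
    (4 * (a : ℂ) ^ 2) • ∑ i, schwartzX v i * schwartzX v i)

theorem symOp_lie_antiOp (a a' : ℝ) (v β : Fin n → ℝ) :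
    symOp a a' v β * antiOp a v - antiOp a v * symOp a a' v β =
      (-8 * (a : ℂ)) • ∑ i, schwartzD i * schwartzD i +
      (32 * (a : ℂ) ^ 3) • ∑ i, schwartzX v i * schwartzX v i -
      Complex.I • ((4 * (a' : ℂ)) • ∑ i, schwartzX v i * schwartzD i +
        (2 * (a' : ℂ) * n) • 1 + (4 * (a : ℂ)) • ∑ i, (β i : ℂ) • schwartzD i) := by
  have hPQ := schwartzD_mul_schwartzX v
  have h1 := lie_sum_mul_sum_sq schwartzD_commute hPQ
  have h2 := lie_sum_mul_sum_sq_left (schwartzX_commute v) hPQ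
  have h3 := lie_sum_sq_sum_sq hPQ
  have h4 := lie_sum_smul_sum_sq (fun i => (β i : ℂ)) hPQ
  have h5 : Commute (∑ i, (β i : ℂ) • schwartzX v i) (∑ i, schwartzX v i * schwartzX v i) :=
    Commute.sum_left _ _ _ fun i _ => Commute.sum_right _ _ _ fun j _ =>
      ((schwartzX_commute v i j).mul_right (schwartzX_commute v i j)).smul_left _
  rw [Ring.lie_def, sub_eq_iff_eq_add] at h1 h2 h3 h4
  have hn : ((Fintype.card (Fin n) : ℕ) : Module.End ℂ 𝓢(Fin n → ℝ, ℂ)) = (n : ℂ) • 1 := by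
    simp [Nat.cast_smul_eq_nsmul]
  have h22 (T : Module.End ℂ 𝓢(Fin n → ℝ, ℂ)) : 2 * T = (2 : ℂ) • T := by
    rw [two_mul, two_smul]
  have h44 (T : Module.End ℂ 𝓢(Fin n → ℝ, ℂ)) : 4 * T = (4 : ℂ) • T := by
    rw [show (4 : Module.End ℂ 𝓢(Fin n → ℝ, ℂ)) = 2 * 2 by norm_num, mul_assoc, h22, h22, smul_smul]
    norm_num
  simp only [hn, h22, h44] at h1 h2 h3 h4
  unfold symOp antiOp
  generalize (∑ i, schwartzX v i * schwartzD i) = E at *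
  generalize (∑ i, schwartzX v i * schwartzX v i) = Q at *
  generalize (∑ i : Fin n, schwartzD i * schwartzD i) = L at *
  generalize (∑ i, (β i : ℂ) • schwartzX v i) = B at *
  generalize (∑ i, (β i : ℂ) • schwartzD i) = B' at *
  simp only [mul_add, add_mul, smul_mul_assoc, mul_smul_comm, smul_add, smul_smul, one_mul,
    mul_one, h1, h2, h3, h4, h5.eq]
  match_scalars <;> ring_nf <;> simp only [Complex.I_sq] <;> ring

theorem integral_mul_conj_schwartzD (i : Fin n) (p q : 𝓢(Fin n → ℝ, ℂ)) :
    ∫ x, p x * (starRingEnd ℂ) (schwartzD i q x) =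
      -∫ x, schwartzD i p x * (starRingEnd ℂ) (q x) := by
  let B : ℂ →L[ℝ] ℂ →L[ℝ] ℂ :=
    ((ContinuousLinearMap.mul ℝ ℂ).flip.comp (Complex.conjCLE : ℂ →L[ℝ] ℂ)).flip
  exact SchwartzMap.integral_bilinear_lineDerivOp_right_eq_neg_left p q B (Pi.single i 1)

theorem integrable_mul_conj (p q : 𝓢(Fin n → ℝ, ℂ)) :
    Integrable fun x => p x * (starRingEnd ℂ) (q x) := by
  let B : ℂ →L[ℝ] ℂ →L[ℝ] ℂ :=
    ((ContinuousLinearMap.mul ℝ ℂ).flip.comp (Complex.conjCLE : ℂ →L[ℝ] ℂ)).flip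
  exact (SchwartzMap.pairing B p q).integrable

/-- The symmetric first order operator `-i∂ᵢ + r + k (xᵢ + vᵢ)`. -/
noncomputable def momOp (v : Fin n → ℝ) (r k : ℝ) (i : Fin n) : Module.End ℂ 𝓢(Fin n → ℝ, ℂ) :=
  (-Complex.I) • schwartzD i + (r : ℂ) • 1 + (k : ℂ) • schwartzX v i

theorem momOp_apply (v : Fin n → ℝ) (r k : ℝ) (i : Fin n) (f : 𝓢(Fin n → ℝ, ℂ))
    (x : Fin n → ℝ) : momOp v r k i f x =
      -Complex.I * schwartzD i f x + (r : ℂ) * f x + ((k * (x i + v i) : ℝ) : ℂ) * f x := by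
  simp [momOp, schwartzX_apply, mul_assoc]

theorem momOp_momOp_apply (v : Fin n → ℝ) (r k : ℝ) (i : Fin n) (f : 𝓢(Fin n → ℝ, ℂ))
    (x : Fin n → ℝ) : momOp v r k i (momOp v r k i f) x =
      -schwartzD i (schwartzD i f) x
        - 2 * Complex.I * (r + k * (x i + v i)) * schwartzD i f x - Complex.I * k * f x
        + (r + k * (x i + v i)) ^ 2 * f x := by
  simp only [momOp, LinearMap.add_apply, LinearMap.smul_apply, Module.End.one_apply, map_add,
    map_smul, schwartzD_schwartzX_self, add_apply, smul_apply,
    schwartzX_apply, smul_eq_mul, Complex.ofReal_add]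
  linear_combination schwartzD i (schwartzD i f) x * Complex.I_sq

theorem integral_momOp_momOp (v : Fin n → ℝ) (r k : ℝ) (i : Fin n) (f : 𝓢(Fin n → ℝ, ℂ)) :
    ∫ x, momOp v r k i (momOp v r k i f) x * (starRingEnd ℂ) (f x) =
      ∫ x, ((‖momOp v r k i f x‖ ^ 2 : ℝ) : ℂ) := by
  set g := momOp v r k i f with hg
  have h := integral_mul_conj_schwartzD i g f
  have e1 (x) : momOp v r k i g x * (starRingEnd ℂ) (f x) =
      -Complex.I * (schwartzD i g x * (starRingEnd ℂ) (f x)) +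
        (((r : ℂ) • g + (k : ℂ) • schwartzX v i g) x * (starRingEnd ℂ) (f x)) := by
    rw [momOp_apply]
    simp [schwartzX_apply]
    ring
  have e2 (x) : ((‖g x‖ ^ 2 : ℝ) : ℂ) =
      Complex.I * (g x * (starRingEnd ℂ) (schwartzD i f x)) +
        (((r : ℂ) • g + (k : ℂ) • schwartzX v i g) x * (starRingEnd ℂ) (f x)) := by
    rw [Complex.ofReal_pow, ← Complex.mul_conj']
    have : (starRingEnd ℂ) (g x) = Complex.I * (starRingEnd ℂ) (schwartzD i f x) +
        (r + k * (x i + v i)) * (starRingEnd ℂ) (f x) := by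
      rw [hg, momOp_apply]
      simp
      ring
    rw [this]
    simp [schwartzX_apply]
    ring
  simp only [e1, e2]
  rw [integral_add ((integrable_mul_conj _ _).const_mul _) (integrable_mul_conj _ _),
    integral_add ((integrable_mul_conj _ _).const_mul _) (integrable_mul_conj _ _),
    integral_const_mul, integral_const_mul, h]
  ring

theorem symOp_apply (a a' : ℝ) (v β : Fin n → ℝ) (f : 𝓢(Fin n → ℝ, ℂ)) (x : Fin n → ℝ) :
    symOp a a' v β f x =
      -2 * Complex.I * (2 * (a : ℂ) * (∑ i, ((x i + v i : ℝ) : ℂ) * pd n i f x) +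
          (a : ℂ) * (n : ℂ) * f x) +
        (a' : ℂ) * ((∑ i, (x i + v i) ^ 2 : ℝ) : ℂ) * f x +
        2 * (a : ℂ) * ((∑ i, β i * (x i + v i) : ℝ) : ℂ) * f x := by
  simp only [symOp, pd_schwartz, LinearMap.add_apply, LinearMap.smul_apply, LinearMap.sum_apply,
    Module.End.mul_apply, Module.End.one_apply, add_apply, smul_apply, sum_apply, schwartzX_apply,
    smul_eq_mul, Complex.ofReal_sum, Complex.ofReal_mul, Complex.ofReal_pow]
  simp only [mul_assoc, Finset.sum_mul, pow_two]

theorem antiOp_apply (a : ℝ) (v : Fin n → ℝ) (f : 𝓢(Fin n → ℝ, ℂ)) (x : Fin n → ℝ) :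
    antiOp a v f x = Complex.I * (lap n f x +
        4 * ((a ^ 2 : ℝ) : ℂ) * ((∑ i, (x i + v i) ^ 2 : ℝ) : ℂ) * f x) := by
  simp only [antiOp, lap_schwartz, LinearMap.add_apply, LinearMap.smul_apply, LinearMap.sum_apply,
    Module.End.mul_apply, add_apply, smul_apply, sum_apply, schwartzX_apply,
    smul_eq_mul, Complex.ofReal_sum, Complex.ofReal_pow]
  simp only [mul_assoc, Finset.sum_mul, pow_two]

theorem deriv_sym {a a' : ℝ → ℝ} {b b' : ℝ → Fin n → ℝ} {t a₁ a₂ : ℝ} {b₁ b₂ : Fin n → ℝ}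
    (ha : HasDerivAt a a₁ t) (ha' : HasDerivAt a' a₂ t) (hb : HasDerivAt b b₁ t)
    (hb' : HasDerivAt b' b₂ t) (x : Fin n → ℝ) (p : Fin n → ℂ) (z : ℂ) :
    deriv (fun τ => -2 * Complex.I * (2 * (a τ : ℂ) * (∑ i, ((x i + b τ i : ℝ) : ℂ) * p i) +
          (a τ : ℂ) * (n : ℂ) * z) +
        (a' τ : ℂ) * ((∑ i, (x i + b τ i) ^ 2 : ℝ) : ℂ) * z +
        2 * (a τ : ℂ) * ((∑ i, b' τ i * (x i + b τ i) : ℝ) : ℂ) * z) t =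
      -2 * Complex.I * (2 * (a₁ : ℂ) * (∑ i, ((x i + b t i : ℝ) : ℂ) * p i) +
          2 * (a t : ℂ) * (∑ i, (b₁ i : ℂ) * p i) + (a₁ : ℂ) * (n : ℂ) * z) +
        ((a₂ : ℂ) * ((∑ i, (x i + b t i) ^ 2 : ℝ) : ℂ) +
          (a' t : ℂ) * ((∑ i, 2 * (x i + b t i) * b₁ i : ℝ) : ℂ)) * z +
        2 * ((a₁ : ℂ) * ((∑ i, b' t i * (x i + b t i) : ℝ) : ℂ) +
          (a t : ℂ) * ((∑ i, (b₂ i * (x i + b t i) + b' t i * b₁ i) : ℝ) : ℂ)) * z := by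
  have hy (i : Fin n) : HasDerivAt (fun τ => x i + b τ i) (b₁ i) t :=
    (hasDerivAt_pi.1 hb i).const_add (x i)
  have h1 : HasDerivAt (fun τ => ∑ i, ((x i + b τ i : ℝ) : ℂ) * p i) (∑ i, (b₁ i : ℂ) * p i) t :=
    HasDerivAt.fun_sum fun i _ => (hy i).ofReal_comp.mul_const (p i)
  have h2 : HasDerivAt (fun τ => ∑ i, (x i + b τ i) ^ 2) (∑ i, 2 * (x i + b t i) * b₁ i) t :=
    HasDerivAt.fun_sum fun i _ => by simpa using (hy i).fun_pow 2
  have h3 : HasDerivAt (fun τ => ∑ i, b' τ i * (x i + b τ i))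
      (∑ i, (b₂ i * (x i + b t i) + b' t i * b₁ i)) t :=
    HasDerivAt.fun_sum fun i _ => (hasDerivAt_pi.1 hb' i).mul (hy i)
  have hac := ha.ofReal_comp
  have h := ((((hac.const_mul 2).mul h1).add ((hac.mul_const (n : ℂ)).mul_const z)).const_mul
    (-2 * Complex.I)).add ((ha'.ofReal_comp.mul h2.ofReal_comp).mul_const z) |>.add
    (((hac.const_mul 2).mul h3.ofReal_comp).mul_const z)
  refine (h.congr_deriv ?_).deriv
  ring

theorem ofReal_sum_sq_norm_eq (F : ℝ) (e : Fin n → ℝ) (f : 𝓢(Fin n → ℝ, ℂ)) (x : Fin n → ℝ) :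
    ((F * (∑ i, (x i + e i) ^ 2) * ‖f x‖ ^ 2 : ℝ) : ℂ) =
      ((F : ℂ) • ∑ i, schwartzX e i (schwartzX e i f)) x * (starRingEnd ℂ) (f x) := by
  simp only [smul_apply, sum_apply, schwartzX_apply, smul_eq_mul, Complex.ofReal_mul,
    Complex.ofReal_pow, ← Complex.mul_conj', Complex.ofReal_sum, ← mul_assoc, ← pow_two,
    ← Finset.sum_mul]

/-- The pointwise form of the identity, before integrating by parts. -/
theorem pointwise_identity {a γ F a₁ a₂ γ₁ : ℝ} (ha : a ≠ 0) (hγ : γ ≠ 0) (hF : F ≠ 0)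
    (hFeq : F = γ * (a₂ + 32 * a ^ 3 - 3 * a₁ ^ 2 / (2 * a) - (a / 2) * (a₁ / a + γ₁ / γ) ^ 2))
    (v b₁ b₂ : Fin n → ℝ) (f : 𝓢(Fin n → ℝ, ℂ)) (x : Fin n → ℝ) :
    (γ : ℂ) * (-2 * Complex.I * (2 * (a₁ : ℂ) * (∑ i, ((x i + v i : ℝ) : ℂ) * pd n i f x) +
          2 * (a : ℂ) * (∑ i, (b₁ i : ℂ) * pd n i f x) + (a₁ : ℂ) * (n : ℂ) * f x) +
        ((a₂ : ℂ) * ((∑ i, (x i + v i) ^ 2 : ℝ) : ℂ) +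
          (a₁ : ℂ) * ((∑ i, 2 * (x i + v i) * b₁ i : ℝ) : ℂ)) * f x +
        2 * ((a₁ : ℂ) * ((∑ i, b₁ i * (x i + v i) : ℝ) : ℂ) +
          (a : ℂ) * ((∑ i, (b₂ i * (x i + v i) + b₁ i * b₁ i) : ℝ) : ℂ)) * f x) +
      (γ : ℂ) * (symOp a a₁ v b₁ * antiOp a v - antiOp a v * symOp a a₁ v b₁) f x +
      (γ₁ : ℂ) * symOp a a₁ v b₁ f x =
    (∑ i, (8 * γ * a : ℂ) * momOp v (b₁ i / 2) (a₁ / (2 * a) + γ₁ / (4 * γ)) i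
        (momOp v (b₁ i / 2) (a₁ / (2 * a) + γ₁ / (4 * γ)) i f) x) +
      (((F : ℂ) • ∑ i, schwartzX (fun i => v i + a * γ * b₂ i / F) i
        (schwartzX (fun i => v i + a * γ * b₂ i / F) i f)) x) -
      ((γ ^ 2 * a ^ 2 * (∑ i, b₂ i ^ 2) / F : ℝ) : ℂ) * f x := by
  obtain ⟨α, rfl⟩ : ∃ α, a₁ = α * a := ⟨a₁ / a, by field_simp⟩
  obtain ⟨θ, rfl⟩ : ∃ θ, γ₁ = θ * γ := ⟨γ₁ / γ, by field_simp⟩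
  have hk : α * a / (2 * a) + θ * γ / (4 * γ) = α / 2 + θ / 4 := by field_simp
  have hFr : F = γ * (a₂ + 32 * a ^ 3 - 3 / 2 * α ^ 2 * a - (a / 2) * (α + θ) ^ 2) := by
    rw [hFeq]
    field_simp
  have hn : (n : ℂ) = ∑ _i : Fin n, 1 := by simp
  have hF' : (F : ℂ) ≠ 0 := mod_cast hF
  have hFc : (F : ℂ) = γ * (a₂ + 32 * a ^ 3 - 3 / 2 * α ^ 2 * a - (a / 2) * (α + θ) ^ 2) := by
    rw [hFr]
    push_cast
    rfl
  have hsq (y c : ℂ) : (F : ℂ) * ((y + a * γ * c / F) * ((y + a * γ * c / F) * f x)) =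
      F * y ^ 2 * f x + 2 * a * γ * c * y * f x + γ ^ 2 * a ^ 2 * c ^ 2 / F * f x := by
    field_simp
    ring
  rw [symOp_lie_antiOp, symOp_apply, hk]
  simp only [momOp_momOp_apply, pd_schwartz, LinearMap.add_apply, LinearMap.sub_apply,
    LinearMap.smul_apply, LinearMap.sum_apply,
    Module.End.mul_apply, Module.End.one_apply, add_apply, sub_apply, smul_apply, sum_apply,
    schwartzX_apply, smul_eq_mul]
  push_cast
  rw [hn]
  simp only [Finset.mul_sum, Finset.sum_mul, Finset.sum_div, ← Finset.sum_add_distrib,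
    ← Finset.sum_sub_distrib]
  refine Finset.sum_congr rfl fun i _ => ?_
  linear_combination -hsq (x i + v i) (b₂ i) - (x i + v i : ℂ) ^ 2 * f x * hFc

end Schwartz

/-- Exact identity: `⟨γS_tf + γ[S,A]f + γ̇Sf, f⟩ = ∫ 8γa|-i∇f + (ḃ/2)f + (ȧ/(2a)+γ̇/(4γ))(x+b)f|²
+ ∫ F(a,γ)|x + b + aγb̈/F(a,γ)|²|f|² - (γ²a²|b̈|²/F(a,γ)) ∫ |f|²` for Schwartz `f`. -/
theorem stmt13 (n : ℕ) (c d : ℝ) (hcd : c < d)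
    (a γ : ℝ → ℝ) (b : ℝ → Fin n → ℝ)
    (ha : ContDiff ℝ (⊤ : ℕ∞) a) (hγ : ContDiff ℝ (⊤ : ℕ∞) γ) (hb : ContDiff ℝ (⊤ : ℕ∞) b)
    (hapos : ∀ t ∈ Icc c d, 0 < a t) (hγpos : ∀ t ∈ Icc c d, 0 < γ t)
    (Fval : ℝ → ℝ)
    (hFval : ∀ t : ℝ, Fval t =
      γ t * (deriv (deriv a) t + 32 * (a t) ^ 3 - 3 * (deriv a t) ^ 2 / (2 * a t) -
        (a t / 2) * (deriv a t / a t + deriv γ t / γ t) ^ 2))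
    (hFpos : ∀ t ∈ Icc c d, 0 < Fval t)
    (S A : ℝ → ((Fin n → ℝ) → ℂ) → (Fin n → ℝ) → ℂ)
    (hS : ∀ (t : ℝ) (f : (Fin n → ℝ) → ℂ) (x : Fin n → ℝ), S t f x =
      -2 * Complex.I * (2 * ((a t : ℝ) : ℂ) * (∑ i, ((x i + b t i : ℝ) : ℂ) * pd n i f x) +
          ((a t : ℝ) : ℂ) * (n : ℂ) * f x) +
        ((deriv a t : ℝ) : ℂ) * ((∑ i, (x i + b t i) ^ 2 : ℝ) : ℂ) * f x +
        2 * ((a t : ℝ) : ℂ) * ((∑ i, deriv b t i * (x i + b t i) : ℝ) : ℂ) * f x)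
    (hA : ∀ (t : ℝ) (f : (Fin n → ℝ) → ℂ) (x : Fin n → ℝ), A t f x =
      Complex.I * (lap n f x +
        4 * (((a t) ^ 2 : ℝ) : ℂ) * ((∑ i, (x i + b t i) ^ 2 : ℝ) : ℂ) * f x)) :
    ∀ (f : SchwartzMap (Fin n → ℝ) ℂ), ∀ t ∈ Icc c d,
      (∫ x : Fin n → ℝ,
          (((γ t : ℝ) : ℂ) * deriv (fun τ => S τ (⇑f) x) t +
            ((γ t : ℝ) : ℂ) * (S t (A t ⇑f) x - A t (S t ⇑f) x) +
            ((deriv γ t : ℝ) : ℂ) * S t (⇑f) x) * (starRingEnd ℂ) (f x)) =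
        (((∫ x : Fin n → ℝ, 8 * γ t * a t *
              ∑ i, ‖-Complex.I * pd n i (⇑f) x + ((deriv b t i / 2 : ℝ) : ℂ) * f x +
                (((deriv a t / (2 * a t) + deriv γ t / (4 * γ t)) * (x i + b t i) : ℝ) : ℂ) *
                  f x‖ ^ 2) +
            (∫ x : Fin n → ℝ, Fval t *
              (∑ i, (x i + b t i + a t * γ t * deriv (deriv b) t i / Fval t) ^ 2) *
                ‖f x‖ ^ 2) -
            ((γ t) ^ 2 * (a t) ^ 2 * (∑ i, (deriv (deriv b) t i) ^ 2) / Fval t) *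
              ∫ x : Fin n → ℝ, ‖f x‖ ^ 2 : ℝ) : ℂ) := by
  intro f t ht
  have ha0 := (hapos t ht).ne'
  have hγ0 := (hγpos t ht).ne'
  have hF0 := (hFpos t ht).ne'
  have da := ((ha.differentiable (by simp)) t).hasDerivAt
  have db := ((hb.differentiable (by simp)) t).hasDerivAt
  have dda := (((contDiff_infty_iff_deriv.1 ha).2.differentiable (by simp)) t).hasDerivAt
  have ddb := (((contDiff_infty_iff_deriv.1 hb).2.differentiable (by simp)) t).hasDerivAt
  have hSf (g : SchwartzMap (Fin n → ℝ) ℂ) :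
      S t g = symOp (a t) (deriv a t) (b t) (deriv b t) g :=
    funext fun x => by rw [hS, symOp_apply]
  have hAf (g : SchwartzMap (Fin n → ℝ) ℂ) : A t g = antiOp (a t) (b t) g :=
    funext fun x => by rw [hA, antiOp_apply]
  set k := deriv a t / (2 * a t) + deriv γ t / (4 * γ t)
  set e : Fin n → ℝ := fun i => b t i + a t * γ t * deriv (deriv b) t i / Fval t with he
  set C := (γ t) ^ 2 * (a t) ^ 2 * (∑ i, (deriv (deriv b) t i) ^ 2) / Fval t
  let P (i : Fin n) := momOp (b t) (deriv b t i / 2) k i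
  have hL (x : Fin n → ℝ) :
      (((γ t : ℝ) : ℂ) * deriv (fun τ => S τ (⇑f) x) t +
            ((γ t : ℝ) : ℂ) * (S t (A t ⇑f) x - A t (S t ⇑f) x) +
            ((deriv γ t : ℝ) : ℂ) * S t (⇑f) x) * (starRingEnd ℂ) (f x) =
        (∑ i, (8 * γ t * a t : ℂ) * (P i (P i f) x * (starRingEnd ℂ) (f x))) +
          ((Fval t : ℂ) • ∑ i, schwartzX e i (schwartzX e i f)) x * (starRingEnd ℂ) (f x) -
          (C : ℂ) * (f x * (starRingEnd ℂ) (f x)) := by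
    have h := pointwise_identity ha0 hγ0 hF0 (hFval t) (b t) (deriv b t) (deriv (deriv b) t) f x
    simp only [hS _ f x]
    rw [deriv_sym da dda db ddb, hAf, hSf, hSf, hAf, ← hS t f x, hSf]
    simp only [← mul_assoc, ← Finset.sum_mul]
    rw [← add_mul, ← sub_mul]
    exact congrArg (· * _) h
  have hR1 (x : Fin n → ℝ) : ((8 * γ t * a t *
      ∑ i, ‖-Complex.I * pd n i (⇑f) x + ((deriv b t i / 2 : ℝ) : ℂ) * f x +
        ((k * (x i + b t i) : ℝ) : ℂ) * f x‖ ^ 2 : ℝ) : ℂ) =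
      ∑ i, (8 * γ t * a t : ℂ) * ((‖P i f x‖ ^ 2 : ℝ) : ℂ) := by
    simp only [P, momOp_apply, pd_schwartz]
    push_cast
    rw [Finset.mul_sum]
  have hPint (i : Fin n) : Integrable fun x => ((‖P i f x‖ ^ 2 : ℝ) : ℂ) := by
    simpa only [Complex.ofReal_pow, ← Complex.mul_conj'] using integrable_mul_conj (P i f) (P i f)
  have hR2 (x : Fin n → ℝ) : ((Fval t * (∑ i, (x i + b t i +
      a t * γ t * deriv (deriv b) t i / Fval t) ^ 2) * ‖f x‖ ^ 2 : ℝ) : ℂ) =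
      ((Fval t : ℂ) • ∑ i, schwartzX e i (schwartzX e i f)) x * (starRingEnd ℂ) (f x) := by
    rw [← ofReal_sum_sq_norm_eq]
    simp only [he, add_assoc]
  simp only [hL]
  have hi1 : Integrable fun x => ∑ i, (8 * γ t * a t : ℂ) *
      (P i (P i f) x * (starRingEnd ℂ) (f x)) :=
    integrable_finsetSum _ fun i _ => (integrable_mul_conj (P i (P i f)) f).const_mul _
  have hi2 := integrable_mul_conj ((Fval t : ℂ) • ∑ i, schwartzX e i (schwartzX e i f)) f
  rw [integral_sub (hi1.fun_add hi2) ((integrable_mul_conj f f).const_mul _),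
    integral_add hi1 hi2,
    integral_finsetSum _ fun i _ => (integrable_mul_conj (P i (P i f)) f).const_mul _]
  rw [Complex.ofReal_sub, Complex.ofReal_add, Complex.ofReal_mul C, ← integral_complex_ofReal,
    ← integral_complex_ofReal, ← integral_complex_ofReal]
  simp only [hR1, hR2]
  rw [integral_finsetSum _ fun i _ => (hPint i).const_mul _]
  simp only [integral_const_mul, Complex.ofReal_pow, ← Complex.mul_conj']
  congr 2
  refine Finset.sum_congr rfl fun i _ => ?_
  rw [integral_momOp_momOp]
  simp only [Complex.ofReal_pow, ← Complex.mul_conj', P]
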